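/- arXiv:1210.0590 — 2 statements merged into one kernel-verified Lean document; each statement's English description precedes it below -/
import Mathlib

section
/- Let V be a nonempty set such that the true lacuna L = L(V) = {Q ∈ W_E : (10Q) ∩ E = (90Q) ∩ E = V} is nonempty. Then (1/γ)·dist(V, E∖V) ≤ sup{diam Q : Q ∈ L} ≤ 40·dist(V, E∖V), where γ is an absolute constant and both sides are interpreted as values in [0, +∞] (with dist(V,∅) = +∞). -/
open scoped ENNReal

noncomputable section

/-- The cube `Q(c,r)` in `ℝⁿ` with the uniform norm: the closed ball of center `c = Q.1` and
radius `r = Q.2`.  A cube is encoded by the pair `Q = (c, r)`. -/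
def cube {n : ℕ} (Q : (Fin n → ℝ) × ℝ) : Set (Fin n → ℝ) :=
  Metric.closedBall Q.1 Q.2

/-- The dilation `λQ = Q(c, λr)` of the cube `Q = (c, r)`. -/
def dilate {n : ℕ} (l : ℝ) (Q : (Fin n → ℝ) × ℝ) : Set (Fin n → ℝ) :=
  Metric.closedBall Q.1 (l * Q.2)

/-- Extended distance between two sets: `dist(A, B) = inf {‖a - b‖ : a ∈ A, b ∈ B}`, with the
convention that it equals `+∞` if one of the sets is empty. -/
def eSetDist {n : ℕ} (A B : Set (Fin n → ℝ)) : ℝ≥0∞ :=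
  ⨅ a ∈ A, ⨅ b ∈ B, edist a b

/-- `W` is a Whitney covering of `ℝⁿ ∖ E`: a countable family of pairwise non-overlapping
cubes whose union is `ℝⁿ ∖ E` and such that `diam Q ≤ dist(Q, E) ≤ 4 diam Q` for all
`Q ∈ W`. -/
structure IsWhitney {n : ℕ} (E : Set (Fin n → ℝ)) (W : Set ((Fin n → ℝ) × ℝ)) : Prop where
  countable : W.Countable
  radius_pos : ∀ Q ∈ W, 0 < Q.2
  nonoverlap : ∀ Q ∈ W, ∀ Q' ∈ W, Q ≠ Q' →
    Disjoint (interior (cube Q)) (interior (cube Q'))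
  union_eq : (⋃ Q ∈ W, cube Q) = Eᶜ
  diam_le_dist : ∀ Q ∈ W, EMetric.diam (cube Q) ≤ eSetDist (cube Q) E
  dist_le_diam : ∀ Q ∈ W, eSetDist (cube Q) E ≤ 4 * EMetric.diam (cube Q)

/-- The true lacuna associated with a set `V`:
`L(V) = {Q ∈ W : (10Q) ∩ E = (90Q) ∩ E = V}`. -/
def lacuna {n : ℕ} (E : Set (Fin n → ℝ)) (W : Set ((Fin n → ℝ) × ℝ))
    (V : Set (Fin n → ℝ)) : Set ((Fin n → ℝ) × ℝ) :=
  {Q ∈ W | dilate 10 Q ∩ E = V ∧ dilate 90 Q ∩ E = V}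

set_option linter.deprecated false in
/-- In positive dimension the uniform-norm diameter of a cube is twice its radius. -/
theorem ediam_cube {n : ℕ} [Nonempty (Fin n)] (Q : (Fin n → ℝ) × ℝ) (hQ : 0 ≤ Q.2) :
    EMetric.diam (cube Q) = ENNReal.ofReal (2 * Q.2) := by
  change Metric.ediam (cube Q) = _
  apply le_antisymm
  · refine Metric.ediam_le fun x hx y hy => ?_
    rw [edist_dist]
    refine ENNReal.ofReal_le_ofReal ?_
    have h := dist_triangle_right x y Q.1
    have hx : dist x Q.1 ≤ Q.2 := hx
    have hy : dist y Q.1 ≤ Q.2 := hy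
    linarith
  · have hmem (t : ℝ) (ht : |t| = Q.2) : Q.1 + (fun _ => t) ∈ cube Q := by
      simp [cube, dist_eq_norm, ht]
    have h := Metric.edist_le_ediam_of_mem (hmem Q.2 (abs_of_nonneg hQ))
      (hmem (-Q.2) (by rw [abs_neg, abs_of_nonneg hQ]))
    have hd : dist (Q.1 + fun _ => Q.2) (Q.1 + fun _ => -Q.2) = 2 * Q.2 := by
      rw [dist_add_left, dist_pi_const, Real.dist_eq, abs_of_nonneg (by linarith)]
      ring
    rwa [edist_dist, hd] at h

theorem ofReal_le_eSetDist_iff {n : ℕ} {A B : Set (Fin n → ℝ)} {t : ℝ} :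
    ENNReal.ofReal t ≤ eSetDist A B ↔ ∀ a ∈ A, ∀ b ∈ B, t ≤ dist a b := by
  simp only [eSetDist, le_iInf_iff, edist_dist, ENNReal.ofReal_le_ofReal_iff dist_nonneg]

theorem exists_dist_lt_of_eSetDist_lt {n : ℕ} {A B : Set (Fin n → ℝ)} {t : ℝ}
    (h : eSetDist A B < ENNReal.ofReal t) : ∃ a ∈ A, ∃ b ∈ B, dist a b < t := by
  contrapose! h
  exact ofReal_le_eSetDist_iff.2 h

/-- If `Q₀` belongs to the lacuna of `V`, then the lacuna contains cubes of every size between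
a multiple of the size of `Q₀` and a fraction of the distance from `V` to `E \ V`. -/
theorem exists_mem_lacuna_le_radius {n : ℕ} [Nonempty (Fin n)] {E : Set (Fin n → ℝ)}
    {W : Set ((Fin n → ℝ) × ℝ)} (hW : IsWhitney E W) {V : Set (Fin n → ℝ)} (hV : V.Nonempty)
    {Q₀ : (Fin n → ℝ) × ℝ} (hQ₀ : Q₀ ∈ lacuna E W V) {s : ℝ} (hs : 500 * Q₀.2 ≤ s)
    (hfar : ∀ v ∈ V, ∀ e ∈ E \ V, 60 * s ≤ dist v e) :
    ∃ Q ∈ lacuna E W V, s ≤ 12 * Q.2 := by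
  obtain ⟨hQ₀W, hV10, -⟩ := hQ₀
  have hr₀ := hW.radius_pos Q₀ hQ₀W
  have hVE : V ⊆ E := hV10 ▸ Set.inter_subset_right
  have hVc : ∀ v ∈ V, dist v Q₀.1 ≤ 10 * Q₀.2 := fun v hv => by
    rw [← hV10] at hv
    exact hv.1
  obtain ⟨v₀, hv₀⟩ := hV
  set x : Fin n → ℝ := Q₀.1 + fun _ => s with hx
  have hxc : dist x Q₀.1 = s := by
    rw [hx, dist_eq_norm, add_sub_cancel_left, pi_norm_const, Real.norm_of_nonneg (by linarith)]
  have hxV : ∀ v ∈ V, s - 10 * Q₀.2 ≤ dist x v ∧ dist x v ≤ s + 10 * Q₀.2 := fun v hv => by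
    have h₁ := dist_triangle x v Q₀.1
    have h₂ := dist_triangle_right x v Q₀.1
    have h₃ := hVc v hv
    constructor <;> linarith
  have hxfar : ∀ e ∈ E \ V, 60 * s - (s + 10 * Q₀.2) ≤ dist x e := fun e he => by
    have h₁ := hfar v₀ hv₀ e he
    have h₂ := dist_triangle_left v₀ e x
    linarith [(hxV v₀ hv₀).2]
  have hxE : x ∈ Eᶜ := fun hxE => by
    by_cases hxmem : x ∈ V
    · have h := (hxV x hxmem).1
      rw [dist_self] at h
      linarith
    · have h := hxfar x ⟨hxE, hxmem⟩
      rw [dist_self] at h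
      linarith
  rw [← hW.union_eq] at hxE
  obtain ⟨Q, hQW, hxQ⟩ := Set.mem_iUnion₂.1 hxE
  have hr := hW.radius_pos Q hQW
  have hlow := hW.diam_le_dist Q hQW
  have hupp := hW.dist_le_diam Q hQW
  rw [ediam_cube Q hr.le] at hlow hupp
  rw [ofReal_le_eSetDist_iff] at hlow
  have hrs := (hlow x hxQ v₀ (hVE hv₀)).trans (hxV v₀ hv₀).2
  have hupp' : eSetDist (cube Q) E < ENNReal.ofReal (17 / 2 * Q.2) := by
    refine hupp.trans_lt ?_
    rw [show (4 : ℝ≥0∞) = ENNReal.ofReal 4 by simp, ← ENNReal.ofReal_mul (by norm_num)]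
    exact (ENNReal.ofReal_lt_ofReal_iff (by positivity)).2 (by linarith)
  obtain ⟨q, hq, e, he, hqe⟩ := exists_dist_lt_of_eSetDist_lt hupp'
  have hxQ : dist x Q.1 ≤ Q.2 := hxQ
  have hq : dist q Q.1 ≤ Q.2 := hq
  have hec : dist e Q.1 ≤ 19 / 2 * Q.2 := by
    have h := dist_triangle_left e Q.1 q
    linarith
  have hxe : dist x e ≤ 21 / 2 * Q.2 := by
    have h := dist_triangle_right x e Q.1
    linarith
  have heV : e ∈ V := by
    by_contra h
    linarith [hxfar e ⟨he, h⟩]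
  have hsr := (hxV e heV).1.trans hxe
  have hVQ : ∀ v ∈ V, dist v Q.1 ≤ 10 * Q.2 := fun v hv => by
    have h₁ := dist_triangle_right v e Q₀.1
    have h₂ := dist_triangle v e Q.1
    linarith [hVc v hv, hVc e heV]
  have hQV : ∀ y ∈ E, dist y Q.1 ≤ 90 * Q.2 → y ∈ V := fun y hy hyQ => by
    by_contra h
    have h₁ := hfar v₀ hv₀ y ⟨hy, h⟩
    have h₂ := dist_triangle_right v₀ y Q.1
    linarith [hVQ v₀ hv₀]
  refine ⟨Q, ⟨hQW, ?_, ?_⟩, by linarith⟩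
  · refine Set.Subset.antisymm (fun y hy => hQV y hy.2 ?_) fun y hy => ⟨hVQ y hy, hVE hy⟩
    have h : dist y Q.1 ≤ 10 * Q.2 := hy.1
    linarith
  · refine Set.Subset.antisymm (fun y hy => hQV y hy.2 hy.1) fun y hy => ⟨?_, hVE hy⟩
    have h := hVQ y hy
    exact h.trans (by linarith)

/-- If the true lacuna `L = L(V)` of a nonempty set `V` is nonempty, then
`(1/γ)·dist(V, E∖V) ≤ sup {diam Q : Q ∈ L} ≤ 40·dist(V, E∖V)` for an absolute constant `γ`,
both sides interpreted in `[0, ∞]` (with `dist(V, ∅) = ∞`). -/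
theorem stmt3 :
    ∃ γ : ℝ≥0∞, 0 < γ ∧ γ ≠ ⊤ ∧
      ∀ (n : ℕ) (E : Set (Fin n → ℝ)) (W : Set ((Fin n → ℝ) × ℝ)),
        E.Nonempty → IsClosed E → IsWhitney E W →
        ∀ V : Set (Fin n → ℝ), V.Nonempty → (lacuna E W V).Nonempty →
          eSetDist V (E \ V) / γ ≤ (⨆ Q ∈ lacuna E W V, EMetric.diam (cube Q)) ∧
          (⨆ Q ∈ lacuna E W V, EMetric.diam (cube Q)) ≤ 40 * eSetDist V (E \ V) := by
  refine ⟨ENNReal.ofReal 60000, by simp, ENNReal.ofReal_ne_top, ?_⟩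
  intro n E W hE _ hW V hV hL
  obtain ⟨Q₀, hQ₀⟩ := hL
  have hn : Nonempty (Fin n) := by
    by_contra h
    rw [not_nonempty_iff] at h
    obtain ⟨e, he⟩ := hE
    have hc : Q₀.1 ∈ Eᶜ := hW.union_eq ▸ Set.mem_biUnion hQ₀.1
      (Metric.mem_closedBall_self (hW.radius_pos Q₀ hQ₀.1).le)
    exact hc (Subsingleton.elim e Q₀.1 ▸ he)
  have hle : ∀ Q ∈ lacuna E W V, ∀ t ≤ 2 * Q.2,
      ENNReal.ofReal t ≤ ⨆ Q ∈ lacuna E W V, EMetric.diam (cube Q) := fun Q hQ t ht => by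
    refine le_trans ?_ (le_iSup₂ (f := fun Q _ => EMetric.diam (cube Q)) Q hQ)
    rw [ediam_cube Q (hW.radius_pos Q hQ.1).le]
    exact ENNReal.ofReal_le_ofReal ht
  constructor
  · refine ENNReal.le_of_forall_nnreal_lt fun p hp => ?_
    rw [ENNReal.lt_div_iff_mul_lt (by simp) (by simp), ← ENNReal.ofReal_coe_nnreal,
      ← ENNReal.ofReal_mul p.coe_nonneg] at hp
    have hfar := ofReal_le_eSetDist_iff.1 hp.le
    rw [← ENNReal.ofReal_coe_nnreal]
    rcases le_total (p : ℝ) (2 * Q₀.2) with h | h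
    · exact hle Q₀ hQ₀ p h
    · obtain ⟨Q, hQ, hpQ⟩ := exists_mem_lacuna_le_radius hW hV hQ₀ (s := 1000 * p)
        (by linarith) fun v hv e he => by linarith [hfar v hv e he]
      exact hle Q hQ p (by linarith [p.coe_nonneg])
  · refine iSup₂_le fun Q hQ => ?_
    have hr := hW.radius_pos Q hQ.1
    rw [ediam_cube Q hr.le]
    refine le_trans (ofReal_le_eSetDist_iff.2 fun v hv e he => ?_)
      (le_mul_of_one_le_left zero_le (by norm_num))
    have hv : dist v Q.1 ≤ 10 * Q.2 := (hQ.2.1 ▸ hv : v ∈ dilate 10 Q ∩ E).1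
    have hfar : 90 * Q.2 < dist e Q.1 := by
      by_contra! h
      exact he.2 (hQ.2.2 ▸ ⟨h, he.1⟩)
    have h := dist_triangle_left e Q.1 v
    linarith
end
end

section
/- Let Q, Q' ∈ W_E be Whitney cubes with Q ∩ Q' ≠ ∅, and suppose that (10Q) ∩ E = (90Q) ∩ E and (10Q') ∩ E = (90Q') ∩ E. Then (10Q) ∩ E = (10Q') ∩ E; that is, any two intersecting Whitney cubes that both belong to true lacunae belong to the same true lacuna. -/
open scoped ENNReal

noncomputable section

theorem ediam_cube_le {n : ℕ} (Q : (Fin n → ℝ) × ℝ) :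
    Metric.ediam (cube Q) ≤ ENNReal.ofReal (2 * Q.2) := by
  refine Metric.ediam_le fun x hx y hy => ?_
  rw [edist_dist]
  refine ENNReal.ofReal_le_ofReal ?_
  have hx' : dist x Q.1 ≤ Q.2 := hx
  have hy' : dist y Q.1 ≤ Q.2 := hy
  linarith [dist_triangle_right x y Q.1]

theorem le_ediam_cube {n : ℕ} [Nonempty (Fin n)] (Q : (Fin n → ℝ) × ℝ) (hr : 0 < Q.2) :
    ENNReal.ofReal (2 * Q.2) ≤ Metric.ediam (cube Q) := by
  have hnorm : ∀ a : ℝ, ‖(fun _ : Fin n => a)‖ = |a| := fun a => pi_norm_const a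
  have hp : Q.1 + (fun _ => Q.2) ∈ cube Q := by
    simp [cube, hnorm, abs_of_pos hr]
  have hm : Q.1 + (fun _ => -Q.2) ∈ cube Q := by
    simp [cube, hnorm, abs_of_pos hr]
  refine le_trans (le_of_eq ?_) (Metric.edist_le_ediam_of_mem hp hm)
  rw [edist_dist, dist_add_left, dist_pi_const, Real.dist_eq, sub_neg_eq_add, ← two_mul,
    abs_of_pos (by positivity)]

theorem IsWhitney.notMem_of_mem_cube {n : ℕ} {E : Set (Fin n → ℝ)} {W : Set ((Fin n → ℝ) × ℝ)}
    (hW : IsWhitney E W) {Q : (Fin n → ℝ) × ℝ} (hQ : Q ∈ W) {x : Fin n → ℝ} (hx : x ∈ cube Q) :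
    x ∉ E := by
  have h : x ∈ ⋃ Q ∈ W, cube Q := Set.mem_biUnion hQ hx
  rwa [hW.union_eq] at h

theorem IsWhitney.two_mul_radius_le_dist {n : ℕ} {E : Set (Fin n → ℝ)}
    {W : Set ((Fin n → ℝ) × ℝ)} (hW : IsWhitney E W) {Q : (Fin n → ℝ) × ℝ} (hQ : Q ∈ W)
    {x y : Fin n → ℝ} (hx : x ∈ cube Q) (hy : y ∈ E) : 2 * Q.2 ≤ dist x y := by
  rcases isEmpty_or_nonempty (Fin n) with _ | _
  · exact absurd (Subsingleton.elim y x ▸ hy) (hW.notMem_of_mem_cube hQ hx)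
  · have h : eSetDist (cube Q) E ≤ edist x y := (iInf₂_le x hx).trans (iInf₂_le y hy)
    have h' := ((le_ediam_cube Q (hW.radius_pos Q hQ)).trans (hW.diam_le_dist Q hQ)).trans h
    rwa [edist_dist, ENNReal.ofReal_le_ofReal_iff dist_nonneg] at h'

theorem IsWhitney.exists_dist_lt {n : ℕ} {E : Set (Fin n → ℝ)} {W : Set ((Fin n → ℝ) × ℝ)}
    (hW : IsWhitney E W) {Q : (Fin n → ℝ) × ℝ} (hQ : Q ∈ W) :
    ∃ x ∈ cube Q, ∃ y ∈ E, dist x y < 9 * Q.2 := by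
  have hr := hW.radius_pos Q hQ
  have h : eSetDist (cube Q) E < ENNReal.ofReal (9 * Q.2) := by
    calc eSetDist (cube Q) E ≤ 4 * Metric.ediam (cube Q) := hW.dist_le_diam Q hQ
      _ ≤ ENNReal.ofReal 4 * ENNReal.ofReal (2 * Q.2) := by
        rw [ENNReal.ofReal_ofNat]
        gcongr
        exact ediam_cube_le Q
      _ = ENNReal.ofReal (4 * (2 * Q.2)) := (ENNReal.ofReal_mul (by norm_num)).symm
      _ < ENNReal.ofReal (9 * Q.2) :=
        (ENNReal.ofReal_lt_ofReal_iff (by linarith)).2 (by linarith)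
  simp only [eSetDist, iInf_lt_iff] at h
  obtain ⟨x, hx, y, hy, hxy⟩ := h
  rw [edist_dist, ENNReal.ofReal_lt_ofReal_iff (by linarith)] at hxy
  exact ⟨x, hx, y, hy, hxy⟩

theorem IsWhitney.radius_le_of_inter_nonempty {n : ℕ} {E : Set (Fin n → ℝ)}
    {W : Set ((Fin n → ℝ) × ℝ)} (hW : IsWhitney E W) {Q Q' : (Fin n → ℝ) × ℝ}
    (hQ : Q ∈ W) (hQ' : Q' ∈ W) (hint : (cube Q ∩ cube Q').Nonempty) :
    2 * Q.2 ≤ 11 * Q'.2 := by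
  obtain ⟨z, hz, hz'⟩ := hint
  obtain ⟨x, hx, y, hy, hxy⟩ := hW.exists_dist_lt hQ'
  have hzy := hW.two_mul_radius_le_dist hQ hz hy
  have hzc : dist z Q'.1 ≤ Q'.2 := hz'
  have hxc : dist x Q'.1 ≤ Q'.2 := hx
  linarith [dist_triangle z x y, dist_triangle_right z x Q'.1]

theorem IsWhitney.dilate_ten_subset_dilate_ninety {n : ℕ} {E : Set (Fin n → ℝ)}
    {W : Set ((Fin n → ℝ) × ℝ)} (hW : IsWhitney E W) {Q Q' : (Fin n → ℝ) × ℝ}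
    (hQ : Q ∈ W) (hQ' : Q' ∈ W) (hint : (cube Q ∩ cube Q').Nonempty) :
    dilate 10 Q ⊆ dilate 90 Q' := by
  have hrad := hW.radius_le_of_inter_nonempty hQ hQ' hint
  have hr' := hW.radius_pos Q' hQ'
  obtain ⟨z, hz, hz'⟩ := hint
  refine Metric.closedBall_subset_closedBall' ?_
  have hzc : dist z Q.1 ≤ Q.2 := hz
  have hzc' : dist z Q'.1 ≤ Q'.2 := hz'
  linarith [dist_triangle_left Q.1 Q'.1 z]

/-- Two intersecting Whitney cubes that both belong to true lacunae (i.e. satisfy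
`(10Q) ∩ E = (90Q) ∩ E`) belong to the same true lacuna: `(10Q) ∩ E = (10Q') ∩ E`. -/
theorem stmt6 (n : ℕ) (E : Set (Fin n → ℝ)) (W : Set ((Fin n → ℝ) × ℝ))
    (hE : E.Nonempty) (hEc : IsClosed E) (hW : IsWhitney E W)
    (Q Q' : (Fin n → ℝ) × ℝ) (hQ : Q ∈ W) (hQ' : Q' ∈ W)
    (hint : (cube Q ∩ cube Q').Nonempty)
    (h1 : dilate 10 Q ∩ E = dilate 90 Q ∩ E)
    (h2 : dilate 10 Q' ∩ E = dilate 90 Q' ∩ E) :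
    dilate 10 Q ∩ E = dilate 10 Q' ∩ E := by
  refine Set.Subset.antisymm ?_ ?_
  · rw [h2]
    exact Set.inter_subset_inter_left E (hW.dilate_ten_subset_dilate_ninety hQ hQ' hint)
  · rw [h1]
    exact Set.inter_subset_inter_left E
      (hW.dilate_ten_subset_dilate_ninety hQ' hQ (Set.inter_comm _ _ ▸ hint))
end
end
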